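/- Let 0<q<1, p=q^{1/2}, and let α,β be real with α,β>−1. For every n∈ℕ and every μ∈ℂ: b_n^{(α,β)}(μ) = Σ_{j=0}^{n} [(p^{−β−n−1};p)_j(−p^{−α−n−1};p)_j/((p;p)_j(p^{−2n−α−β−2};p)_j)]·(−1)^j·p^{j/2}·μ^{n−j}·Σ_{k=0}^{j} [(p^{−j};p)_k(p^{2n+α+β+3−j};p)_k(p^{β+1};p)_k(−p^{α+1};p)_k/((p;p)_k(p^{α+β+2};p)_k(p^{n+β+2−j};p)_k(−p^{α+n+2−j};p)_k)]·p^k. -/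

import Mathlib

open Finset Filter

/-- `rpw q t` is the complex number `q^t` (real power, `q > 0`). -/
noncomputable def rpw (q t : ℝ) : ℂ := ((q ^ t : ℝ) : ℂ)

/-- Finite q-shifted factorial `(a; qq)_n`. -/
noncomputable def qPoch (a qq : ℂ) (n : ℕ) : ℂ := ∏ j ∈ Finset.range n, (1 - a * qq ^ j)

/-- The additive coefficient in the three-term recurrence of the monic polynomials
`b_k^{(α,β)}` (base `p`). -/
noncomputable def Aterm (p α β : ℝ) (k : ℕ) : ℂ :=
  ((1 - rpw p (β - α)) * (1 + rpw p (α + β + 3 + 2*(k : ℝ))) /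
   ((1 - rpw p (α + β + 2 + 2*(k : ℝ))) * (1 - rpw p (α + β + 4 + 2*(k : ℝ))))) *
  rpw p (α + 3/2 + (k : ℝ))

/-- The coefficient of `b_{k-1}` in the three-term recurrence of `b_k^{(α,β)}`. -/
noncomputable def Cterm (p α β : ℝ) (k : ℕ) : ℂ :=
  (1 - rpw p (2*α + 2 + 2*(k : ℝ))) * (1 - rpw p (2*β + 2 + 2*(k : ℝ))) *
    rpw p (α + β + 2 + 2*(k : ℝ)) /
  ((1 - rpw p (α + β + 1 + 2*(k : ℝ))) * (1 - rpw p (α + β + 2 + 2*(k : ℝ)))^2 *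
   (1 - rpw p (α + β + 3 + 2*(k : ℝ))))

/-- The monic polynomials `b_k^{(α,β)}` (evaluated at `μ`). -/
noncomputable def bpoly (p α β : ℝ) : ℕ → ℂ → ℂ
  | 0 => fun _ => 1
  | 1 => fun μ => μ + Aterm p α β 0
  | (k+2) => fun μ => bpoly p α β (k+1) μ * (μ + Aterm p α β (k+1)) +
      Cterm p α β (k+1) * bpoly p α β k μ

/-- The descending shifted factorial `∏_{i<m} (1 - a p^{-i})`. -/
noncomputable def descPoch (a p : ℂ) (m : ℕ) : ℂ := ∏ i ∈ Finset.range m, (1 - a / p ^ i)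

lemma qPoch_zero (a p : ℂ) : qPoch a p 0 = 1 := by simp [qPoch]

lemma qPoch_succ (a p : ℂ) (k : ℕ) : qPoch a p (k + 1) = qPoch a p k * (1 - a * p ^ k) := by
  simp [qPoch, Finset.prod_range_succ]

lemma qPoch_succ' (a p : ℂ) (k : ℕ) : qPoch a p (k + 1) = (1 - a) * qPoch (a * p) p k := by
  simp only [qPoch, Finset.prod_range_succ', pow_zero, mul_one]
  rw [mul_comm]
  congr 1
  exact Finset.prod_congr rfl fun i _ => by ring

lemma qPoch_ne_zero {a p : ℂ} (h : ∀ i : ℕ, 1 - a * p ^ i ≠ 0) (k : ℕ) : qPoch a p k ≠ 0 :=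
  Finset.prod_ne_zero_iff.mpr fun i _ => h i

lemma descPoch_zero (a p : ℂ) : descPoch a p 0 = 1 := by simp [descPoch]

lemma descPoch_succ (a p : ℂ) (m : ℕ) :
    descPoch a p (m + 1) = descPoch a p m * (1 - a / p ^ m) := by
  simp [descPoch, Finset.prod_range_succ]

lemma descPoch_mul_succ {p : ℂ} (hp : p ≠ 0) (a : ℂ) (m : ℕ) :
    descPoch (a * p) p (m + 1) = (1 - a * p) * descPoch a p m := by
  simp only [descPoch, Finset.prod_range_succ', pow_zero, div_one]
  rw [mul_comm]
  congr 1
  exact Finset.prod_congr rfl fun i _ => by rw [pow_succ, mul_div_mul_right _ _ hp]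

lemma descPoch_ne_zero {a p : ℂ} {m : ℕ} (h : ∀ i < m, 1 - a / p ^ i ≠ 0) :
    descPoch a p m ≠ 0 :=
  Finset.prod_ne_zero_iff.mpr fun i hi => h i (Finset.mem_range.mp hi)

lemma descPoch_add {p : ℂ} (hp : p ≠ 0) (a : ℂ) (m k : ℕ) :
    descPoch a p (m + k) = descPoch a p m * qPoch (a * p / p ^ (m + k)) p k := by
  induction k with
  | zero => simp [qPoch_zero]
  | succ k ih =>
    rw [← add_assoc, descPoch_succ, ih, qPoch_succ']
    have h₁ : a * p / p ^ (m + k + 1) = a / p ^ (m + k) := by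
      rw [pow_succ, mul_div_mul_right _ _ hp]
    rw [h₁, div_mul_eq_mul_div]
    ring

lemma qPoch_inv {a p : ℂ} (hp : p ≠ 0) (ha : a ≠ 0) (k : ℕ) :
    qPoch a⁻¹ p k = (-1) ^ k * (∏ i ∈ Finset.range k, p ^ i) / a ^ k * descPoch a p k := by
  induction k with
  | zero => simp [qPoch_zero, descPoch_zero]
  | succ k ih =>
    rw [qPoch_succ, ih, descPoch_succ, Finset.prod_range_succ]
    field_simp
    ring

lemma descPoch_pow_mul_qPoch {p : ℂ} (hp : p ≠ 0) (m k : ℕ) :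
    descPoch (p ^ (m + k)) p k * qPoch p p m = qPoch p p (m + k) := by
  induction k with
  | zero => simp [descPoch_zero]
  | succ k ih =>
    rw [← add_assoc, pow_succ, descPoch_mul_succ hp, qPoch_succ, ← ih]
    ring

lemma prod_pow_mul_pow {p h : ℂ} (hh : h ^ 2 = p) (k : ℕ) :
    (∏ i ∈ Finset.range k, p ^ i) * h ^ k = h ^ (k ^ 2) := by
  induction k with
  | zero => simp
  | succ k ih =>
    rw [Finset.prod_range_succ, show (k + 1) ^ 2 = k ^ 2 + (2 * k + 1) by ring, pow_add h (k ^ 2),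
      ← ih, ← hh]
    ring

/-- An indefinite summation formula for a terminating-type `₂φ₁` with `c = abq` and argument `q`. -/
lemma sum_qPoch_telescope {a b p : ℂ} (hp : ∀ i : ℕ, 1 - p * p ^ i ≠ 0)
    (hc : ∀ i : ℕ, 1 - a * b * p * p ^ i ≠ 0) (K : ℕ) :
    ∑ k ∈ Finset.range (K + 1),
      qPoch a p k * qPoch b p k / (qPoch p p k * qPoch (a * b * p) p k) * p ^ k =
    qPoch (a * p) p K * qPoch (b * p) p K / (qPoch p p K * qPoch (a * b * p) p K) := by
  induction K with
  | zero => simp [qPoch_zero]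
  | succ K ih =>
    rw [Finset.sum_range_succ, ih, qPoch_succ' a, qPoch_succ' b, qPoch_succ (a * p),
      qPoch_succ (b * p), qPoch_succ p, qPoch_succ (a * b * p)]
    have h₁ := qPoch_ne_zero hp K
    have h₂ := qPoch_ne_zero hc K
    have h₃ := hp K
    have h₄ := hc K
    clear ih hc
    generalize hab : a * b * p = c at *
    generalize hd : 1 - c * p ^ K = d at *
    field_simp
    rw [← hd, ← hab]
    ring

/-- The `n`-independent factor of the coefficients of `bpoly`. -/
noncomputable def phiCoeff (x y p h : ℂ) (k : ℕ) : ℂ :=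
  h ^ k * qPoch y p k * qPoch (-x) p k / (qPoch p p k * qPoch (x * y) p k)

/-- The factor of the coefficients of `bpoly` that solves the three-term recurrence. -/
noncomputable def psiCoeff (x y p h : ℂ) (n m : ℕ) : ℂ :=
  (-1) ^ m * h ^ (m ^ 2) * descPoch (y * p ^ n) p m * descPoch (-x * p ^ n) p m /
    (qPoch p p m * descPoch (x * y * p ^ (2 * n)) p m)

/-- The coefficient of `μ^{n-j}` in `b_n`, as a convolution. -/
noncomputable def bCoeff (x y p h : ℂ) (n j : ℕ) : ℂ :=
  ∑ k ∈ Finset.range (j + 1), phiCoeff x y p h k * psiCoeff x y p h n (j - k)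

/-- `Aterm` in terms of `x = p^{α+1}`, `y = p^{β+1}`, `h = p^{1/2}`. -/
noncomputable def recA (x y p h : ℂ) (n : ℕ) : ℂ :=
  (x - y) * p ^ n * h * (1 + x * y * p ^ (2 * n + 1)) /
    ((1 - x * y * p ^ (2 * n)) * (1 - x * y * p ^ (2 * n + 2)))

/-- `Cterm` at index `n + 1` in terms of `x = p^{α+1}`, `y = p^{β+1}`. -/
noncomputable def recC (x y p : ℂ) (n : ℕ) : ℂ :=
  (1 - x ^ 2 * p ^ (2 * n + 2)) * (1 - y ^ 2 * p ^ (2 * n + 2)) * (x * y * p ^ (2 * n + 2)) /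
    ((1 - x * y * p ^ (2 * n + 1)) * (1 - x * y * p ^ (2 * n + 2)) ^ 2 *
      (1 - x * y * p ^ (2 * n + 3)))

lemma psiCoeff_zero (x y p h : ℂ) (n : ℕ) : psiCoeff x y p h n 0 = 1 := by
  simp [psiCoeff, descPoch_zero, qPoch_zero]

lemma psiCoeff_one_rec {x y p : ℂ} (h : ℂ) (hp : ∀ i : ℕ, 1 - p * p ^ i ≠ 0)
    (hw : ∀ i : ℕ, 1 - x * y * p ^ i ≠ 0) (n : ℕ) :
    psiCoeff x y p h (n + 1) 1 = psiCoeff x y p h n 1 + recA x y p h n := by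
  have h₀ : 1 - p ≠ 0 := by simpa using hp 0
  have h₁ := hw (2 * n)
  have h₂ := hw (2 * n + 2)
  simp only [psiCoeff, recA, descPoch_succ, descPoch_zero, qPoch_succ, qPoch_zero]
  simp only [pow_zero, div_one, mul_one, one_mul, one_pow, pow_one, mul_add]
  simp only [pow_add, pow_mul, mul_comm 2 n, pow_one] at h₁ h₂ ⊢
  generalize p ^ n = N at *
  generalize hd₀ : 1 - x * y * N ^ 2 = d₀ at *
  generalize hd₂ : 1 - x * y * (N ^ 2 * p ^ 2) = d₂ at *
  field_simp
  rw [← hd₀, ← hd₂]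
  ring

/-- The rational function identity behind the three-term recurrence. -/
lemma psiCoeff_rational_identity {u v p M : ℂ} (he₁ : 1 - p * M ≠ 0) (he₂ : 1 - p * (p * M) ≠ 0)
    (hd₂ : 1 - u * v * p ^ 2 ≠ 0) (hd₃ : 1 - u * v * p ^ 3 ≠ 0) (hd₄ : 1 - u * v * p ^ 4 ≠ 0)
    (hg₁ : M - u * v * p ≠ 0) (hg₂ : M - u * v * p ^ 2 ≠ 0) :
    (1 - u * p ^ 2) * (1 + v * p ^ 2) /
        ((1 - p * M) * (1 - p * (p * M)) * (1 - u * v * p ^ 3) * (1 - u * v * p ^ 4)) =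
      (M - u) * (M + v) /
          ((1 - p * M) * (1 - p * (p * M)) * (M - u * v * p) * (M - u * v * p ^ 2)) -
        (v - u) * (1 + u * v * p ^ 3) /
          ((1 - u * v * p ^ 2) * (1 - u * v * p ^ 4) * (1 - p * M) * (M - u * v * p ^ 2)) +
        (1 + u * p) * (1 - v * p) * (u * v) /
          ((1 - u * v * p ^ 2) * (1 - u * v * p ^ 3) * (M - u * v * p) * (M - u * v * p ^ 2)) := by
  generalize hE₁ : 1 - p * M = e₁ at *
  generalize hE₂ : 1 - p * (p * M) = e₂ at *
  generalize hD₂ : 1 - u * v * p ^ 2 = d₂ at *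
  generalize hD₃ : 1 - u * v * p ^ 3 = d₃ at *
  generalize hD₄ : 1 - u * v * p ^ 4 = d₄ at *
  generalize hG₁ : M - u * v * p = g₁ at *
  generalize hG₂ : M - u * v * p ^ 2 = g₂ at *
  field_simp
  rw [← hE₁, ← hE₂, ← hD₂, ← hD₃, ← hD₄, ← hG₁, ← hG₂]
  ring

lemma psiCoeff_rec {x y p h : ℂ} (hh : h ^ 2 = p) (hp₀ : p ≠ 0) (hp : ∀ i : ℕ, 1 - p * p ^ i ≠ 0)
    (hw : ∀ i : ℕ, 1 - x * y * p ^ i ≠ 0) {n m : ℕ} (hmn : m ≤ n) :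
    psiCoeff x y p h (n + 2) (m + 2) = psiCoeff x y p h (n + 1) (m + 2) +
      recA x y p h (n + 1) * psiCoeff x y p h (n + 1) (m + 1) +
      recC x y p n * psiCoeff x y p h n m := by
  have hD : ∀ a : ℂ, descPoch (a * p ^ (n + 2)) p (m + 2) =
      (1 - a * p ^ n * p * p) * ((1 - a * p ^ n * p) * descPoch (a * p ^ n) p m) := fun a => by
    rw [show a * p ^ (n + 2) = a * p ^ n * p * p by ring, descPoch_mul_succ hp₀,
      descPoch_mul_succ hp₀]
  have hD₁ : ∀ a : ℂ, descPoch (a * p ^ (n + 1)) p (m + 1) =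
      (1 - a * p ^ n * p) * descPoch (a * p ^ n) p m := fun a => by
    rw [show a * p ^ (n + 1) = a * p ^ n * p by ring, descPoch_mul_succ hp₀]
  have hD₂ : ∀ a : ℂ, descPoch (a * p ^ (n + 1)) p (m + 2) =
      (1 - a * p ^ n * p) * (descPoch (a * p ^ n) p m * (1 - a * p ^ n / p ^ m)) := fun a => by
    rw [show a * p ^ (n + 1) = a * p ^ n * p by ring, descPoch_mul_succ hp₀, descPoch_succ]
  set W := descPoch (x * y * p ^ (2 * n)) p m with hW
  have hE : descPoch (x * y * p ^ (2 * (n + 1))) p (m + 2) =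
      (1 - x * y * p ^ (2 * n) * p * p) * ((1 - x * y * p ^ (2 * n) * p) * W) := by
    rw [show x * y * p ^ (2 * (n + 1)) = x * y * p ^ (2 * n) * p * p by ring,
      descPoch_mul_succ hp₀, descPoch_mul_succ hp₀]
  have hv₁ : 1 - x * y * p ^ (2 * n) * p / p ^ m ≠ 0 := by
    convert hw (2 * n - m + 1) using 2
    rw [mul_div_assoc, mul_assoc (x * y), ← mul_div_assoc, ← pow_succ,
      show 2 * n + 1 = (2 * n - m + 1) + m by omega, pow_add _ _ m, mul_div_assoc,
      div_self (pow_ne_zero _ hp₀), mul_one]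
  have hv₂ : 1 - x * y * p ^ (2 * n) * p * p / p ^ m ≠ 0 := by
    convert hw (2 * n - m + 2) using 2
    rw [show x * y * p ^ (2 * n) * p * p / p ^ m = x * y * (p ^ (2 * n + 2) / p ^ m) by ring,
      show 2 * n + 2 = (2 * n - m + 2) + m by omega, pow_add _ _ m, mul_div_assoc,
      div_self (pow_ne_zero _ hp₀), mul_one]
  have hV₂ : descPoch (x * y * p ^ (2 * (n + 1))) p (m + 1) =
      descPoch (x * y * p ^ (2 * n + 2)) p m * (1 - x * y * p ^ (2 * n) * p * p / p ^ m) := by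
    rw [descPoch_succ, show x * y * p ^ (2 * (n + 1)) = x * y * p ^ (2 * n + 2) by ring,
      show x * y * p ^ (2 * n) * p * p = x * y * p ^ (2 * n + 2) by ring]
  have hV : descPoch (x * y * p ^ (2 * (n + 1))) p (m + 2) =
      descPoch (x * y * p ^ (2 * n + 2)) p m * (1 - x * y * p ^ (2 * n) * p * p / p ^ m) *
        (1 - x * y * p ^ (2 * n) * p / p ^ m) := by
    rw [descPoch_succ, hV₂,
      show x * y * p ^ (2 * (n + 1)) / p ^ (m + 1) = x * y * p ^ (2 * n) * p / p ^ m by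
        rw [show 2 * (n + 1) = 2 * n + 1 + 1 by ring, pow_succ p m, pow_succ p (2 * n + 1),
          ← mul_assoc (x * y), mul_div_mul_right _ _ hp₀, pow_succ, ← mul_assoc (x * y)]]
  have hV₄ : descPoch (x * y * p ^ (2 * (n + 2))) p (m + 2) =
      (1 - x * y * p ^ (2 * n) * p ^ 4) * ((1 - x * y * p ^ (2 * n) * p ^ 3) *
        descPoch (x * y * p ^ (2 * n + 2)) p m) := by
    rw [show x * y * p ^ (2 * (n + 2)) = x * y * p ^ (2 * n + 2) * p * p by ring,
      descPoch_mul_succ hp₀, descPoch_mul_succ hp₀]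
    ring
  have hV₀ : descPoch (x * y * p ^ (2 * n + 2)) p m ≠ 0 := by
    refine descPoch_ne_zero fun i hi => ?_
    convert hw (2 * n + 2 - i) using 2
    rw [mul_div_assoc, pow_sub₀ _ hp₀ (by omega), div_eq_mul_inv]
  set V := descPoch (x * y * p ^ (2 * n + 2)) p m
  have hw₂ := hw (2 * n + 2)
  have hw₃ := hw (2 * n + 3)
  have hw₄ := hw (2 * n + 4)
  have hh₁ : h ^ ((m + 1) ^ 2) = h ^ (m ^ 2) * p ^ m * h := by rw [← hh]; ring
  have hh₂ : h ^ ((m + 2) ^ 2) = h ^ (m ^ 2) * (p ^ m) ^ 2 * p ^ 2 := by rw [← hh]; ring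
  have hm : p ^ m ≠ 0 := pow_ne_zero _ hp₀
  have hq := qPoch_ne_zero hp m
  have he₁ := hp m
  have he₂ : 1 - p * (p * p ^ m) ≠ 0 := by simpa only [pow_succ'] using hp (m + 1)
  have hC : recC x y p n / W =
      (1 - x ^ 2 * p ^ (2 * n + 2)) * (1 - y ^ 2 * p ^ (2 * n + 2)) * (x * y * p ^ (2 * n + 2)) /
        ((1 - x * y * p ^ (2 * n + 2)) * (1 - x * y * p ^ (2 * n + 3)) *
          (V * (1 - x * y * p ^ (2 * n) * p * p / p ^ m) *
            (1 - x * y * p ^ (2 * n) * p / p ^ m))) := by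
    rw [← hV, hE, recC, show x * y * p ^ (2 * n) * p * p = x * y * p ^ (2 * n + 2) by ring,
      show x * y * p ^ (2 * n) * p = x * y * p ^ (2 * n + 1) by ring]
    clear_value W V
    generalize 1 - x * y * p ^ (2 * n + 1) = d₁ at *
    generalize 1 - x * y * p ^ (2 * n + 2) = d₂ at *
    generalize 1 - x * y * p ^ (2 * n + 3) = d₃ at *
    field_simp
  have hψ : recC x y p n * psiCoeff x y p h n m = (-1) ^ m * h ^ (m ^ 2) *
      descPoch (y * p ^ n) p m * descPoch (-x * p ^ n) p m / qPoch p p m *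
        (recC x y p n / W) := by
    rw [psiCoeff, ← hW]; ring
  have hg : ∀ a : ℂ, 1 - a / p ^ m = (p ^ m - a) / p ^ m := fun a => by
    rw [sub_div, div_self hm]
  rw [hg, div_ne_zero_iff] at hv₁ hv₂
  rw [hψ, hC]
  simp only [psiCoeff, recA, hD, hD₁, hD₂, hV, hV₂, hV₄, hh₁, hh₂, qPoch_succ, hg]
  clear hD hD₁ hD₂ hE hV hV₂ hV₄ hh₁ hh₂ hW hp hw hmn hC hψ hg
  clear_value V W
  have hx : x * y * p ^ (2 * n) = (y * p ^ n) * (x * p ^ n) := by ring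
  have hxs : ∀ i, x * y * p ^ (2 * n + i) = (y * p ^ n) * (x * p ^ n) * p ^ i := fun i => by ring
  have key := psiCoeff_rational_identity (u := y * p ^ n) (v := x * p ^ n) he₁ he₂
    (by rwa [← hxs]) (by rwa [← hxs]) (by rwa [← hxs]) (by rw [← hx]; exact hv₁.1)
    (by rw [← hx]; convert hv₂.1 using 2; ring)
  rw [show 2 * (n + 1) + 1 = 2 * n + 3 by ring, show 2 * (n + 1) = 2 * n + 2 by ring,
    show 2 * n + 2 + 2 = 2 * n + 4 by ring, show x ^ 2 * p ^ (2 * n + 2) = (x * p ^ n * p) ^ 2 by ring,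
    show y ^ 2 * p ^ (2 * n + 2) = (y * p ^ n * p) ^ 2 by ring, ← pow_succ' p m, pow_succ' p m,
    pow_succ p n, ← mul_assoc (x - y)]
  simp only [hxs, hx, neg_mul, sub_neg_eq_add] at *
  have h₂ : (y * p ^ n) * (x * p ^ n) * p * p = (y * p ^ n) * (x * p ^ n) * p ^ 2 := by ring
  simp only [h₂] at *
  generalize descPoch (y * p ^ n) p m = Y
  generalize descPoch (-(x * p ^ n)) p m = X
  generalize qPoch p p m = Q at *
  generalize h ^ (m ^ 2) = H
  generalize p ^ m = M at *
  rw [show (x - y) * p ^ n * p = (x * p ^ n - y * p ^ n) * p by ring]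
  generalize y * p ^ n = u at *
  generalize x * p ^ n = v at *
  generalize 1 - p * M = e₁ at *
  generalize 1 - p * (p * M) = e₂ at *
  generalize 1 - u * v * p ^ 2 = d₂ at *
  generalize 1 - u * v * p ^ 3 = d₃ at *
  generalize 1 - u * v * p ^ 4 = d₄ at *
  generalize M - u * v * p = g₁ at *
  generalize M - u * v * p ^ 2 = g₂ at *
  trans (-1) ^ m * H * Y * X / (Q * V) * M ^ 2 * p ^ 2 * (1 - u * p) * (1 + v * p) *
    ((1 - u * p ^ 2) * (1 + v * p ^ 2) / (e₁ * e₂ * d₃ * d₄))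
  · ring
  rw [key]
  subst hh
  have hg₁ := hv₁.1
  have hg₂ := hv₂.1
  clear key hv₁ hv₂
  field_simp
  ring

/-- The summand of the inner `₄φ₃`, with `x = p^{α+1}` and `y = p^{β+1}`. -/
noncomputable def innerTerm (x y p : ℂ) (n j k : ℕ) : ℂ :=
  qPoch (p ^ j)⁻¹ p k * qPoch (x * y * p ^ (2 * n) * p / p ^ j) p k * qPoch y p k *
      qPoch (-x) p k /
    (qPoch p p k * qPoch (x * y) p k * qPoch (y * p ^ n * p / p ^ j) p k *
      qPoch (-x * p ^ n * p / p ^ j) p k) * p ^ k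

lemma psiCoeff_eq {x y p h : ℂ} (hh : h ^ 2 = p) (hp₀ : p ≠ 0) (hx₀ : x ≠ 0) (hy₀ : y ≠ 0)
    (n j : ℕ) :
    qPoch (y * p ^ n)⁻¹ p j * qPoch (-x * p ^ n)⁻¹ p j /
      (qPoch p p j * qPoch (x * y * p ^ (2 * n))⁻¹ p j) * (-1) ^ j * h ^ j =
    psiCoeff x y p h n j := by
  have hP : (∏ i ∈ Finset.range j, p ^ i) ≠ 0 :=
    Finset.prod_ne_zero_iff.mpr fun i _ => pow_ne_zero _ hp₀
  have hn : p ^ n ≠ 0 := pow_ne_zero _ hp₀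
  have hs : ((-1 : ℂ) ^ j) ^ 2 = 1 := by rw [← pow_mul, mul_comm, pow_mul]; simp
  rw [psiCoeff, qPoch_inv hp₀ (mul_ne_zero hy₀ hn), qPoch_inv hp₀ (by simp [hx₀, hp₀]),
    qPoch_inv hp₀ (mul_ne_zero (mul_ne_zero hx₀ hy₀) (pow_ne_zero _ hp₀)),
    ← prod_pow_mul_pow hh j, neg_mul, neg_pow (x * p ^ n),
    show x * y * p ^ (2 * n) = (y * p ^ n) * (x * p ^ n) by ring, mul_pow (y * p ^ n)]
  have hu : (y * p ^ n) ^ j ≠ 0 := pow_ne_zero _ (mul_ne_zero hy₀ hn)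
  have hv : (x * p ^ n) ^ j ≠ 0 := pow_ne_zero _ (mul_ne_zero hx₀ hn)
  have hs₀ : (-1 : ℂ) ^ j ≠ 0 := pow_ne_zero _ (by norm_num)
  generalize descPoch (y * p ^ n) p j = Y
  generalize descPoch (-(x * p ^ n)) p j = X
  generalize descPoch (y * p ^ n * (x * p ^ n)) p j = W
  generalize (y * p ^ n) ^ j = u at *
  generalize (x * p ^ n) ^ j = v at *
  generalize (-1 : ℂ) ^ j = s at *
  generalize (∏ i ∈ Finset.range j, p ^ i) = P at *
  have hc : s * P / u * Y * (s * P / (s * v) * X) /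
      (qPoch p p j * (s * P / (u * v) * W)) = P * Y * X / (qPoch p p j * W) := by
    rcases eq_or_ne (qPoch p p j * W) 0 with h0 | h0
    · rw [h0, show qPoch p p j * (s * P / (u * v) * W) =
        s * P / (u * v) * (qPoch p p j * W) by ring, h0]
      simp
    · have h1 := left_ne_zero_of_mul h0
      have h2 := right_ne_zero_of_mul h0
      field_simp
  rw [hc]
  ring

lemma qPoch_shift_ne_zero {a p : ℂ} (hp₀ : p ≠ 0) (ha : ∀ i : ℕ, 1 - a * p ^ i ≠ 0) {r j : ℕ}
    (hj : j ≤ r + 1) (k : ℕ) : qPoch (a * p ^ r * p / p ^ j) p k ≠ 0 := by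
  refine qPoch_ne_zero (fun i => ?_) k
  convert ha (r + 1 - j + i) using 2
  rw [pow_add, pow_sub₀ _ hp₀ hj, pow_succ]
  ring

lemma psiCoeff_mul_innerTerm {x y p h : ℂ} (hh : h ^ 2 = p) (hp₀ : p ≠ 0)
    (hp : ∀ i : ℕ, 1 - p * p ^ i ≠ 0) (hw : ∀ i : ℕ, 1 - x * y * p ^ i ≠ 0)
    (hx : ∀ i : ℕ, 1 - -x * p ^ i ≠ 0) (hy : ∀ i : ℕ, 1 - y * p ^ i ≠ 0)
    {n j k : ℕ} (hj : j ≤ n + 1) (hk : k ≤ j) :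
    psiCoeff x y p h n j * innerTerm x y p n j k =
      phiCoeff x y p h k * psiCoeff x y p h n (j - k) := by
  obtain ⟨m, rfl⟩ := Nat.exists_eq_add_of_le' hk
  rw [Nat.add_sub_cancel]
  have hh₀ : h ≠ 0 := by rintro rfl; exact hp₀ (by rw [← hh]; simp)
  have hX := qPoch_shift_ne_zero hp₀ hx hj k
  have hY := qPoch_shift_ne_zero hp₀ hy hj k
  have hW := qPoch_shift_ne_zero hp₀ hw (r := 2 * n) (j := m + k) (by omega) k
  have hpow : h ^ ((m + k) ^ 2) * (∏ i ∈ Finset.range k, p ^ i) * p ^ k =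
      h ^ k * h ^ (m ^ 2) * (p ^ (m + k)) ^ k := by
    apply mul_right_cancel₀ (pow_ne_zero k hh₀)
    calc _ = h ^ ((m + k) ^ 2) * ((∏ i ∈ Finset.range k, p ^ i) * h ^ k) * p ^ k := by ring
      _ = _ := by rw [prod_pow_mul_pow hh, ← hh]; ring
  have hQ := descPoch_pow_mul_qPoch hp₀ m k
  have hQm := qPoch_ne_zero hp m
  have hQk := qPoch_ne_zero hp k
  have hQj := qPoch_ne_zero hp (m + k)
  have hwk := qPoch_ne_zero hw k
  have hpj : (p ^ (m + k)) ^ k ≠ 0 := pow_ne_zero _ (pow_ne_zero _ hp₀)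
  have hs : (-1 : ℂ) ^ (m + k) * (-1) ^ k = (-1) ^ m := by
    rw [pow_add, mul_assoc, ← mul_pow]; simp
  rw [psiCoeff, psiCoeff, phiCoeff, innerTerm, descPoch_add hp₀ (y * p ^ n),
    descPoch_add hp₀ (-x * p ^ n), descPoch_add hp₀ (x * y * p ^ (2 * n)),
    qPoch_inv hp₀ (pow_ne_zero _ hp₀), ← hs, ← hQ]
  rw [← hQ] at hQj
  have hD := left_ne_zero_of_mul hQj
  generalize qPoch (x * y * p ^ (2 * n) * p / p ^ (m + k)) p k = W' at *
  generalize qPoch (y * p ^ n * p / p ^ (m + k)) p k = Y' at *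
  generalize qPoch (-x * p ^ n * p / p ^ (m + k)) p k = X' at *
  generalize descPoch (y * p ^ n) p m = Y
  generalize descPoch (-x * p ^ n) p m = X
  generalize descPoch (x * y * p ^ (2 * n)) p m = W
  generalize (-1 : ℂ) ^ (m + k) = s
  generalize (-1 : ℂ) ^ k = t
  generalize descPoch (p ^ (m + k)) p k = D at *
  generalize qPoch p p m = Qm at *
  generalize qPoch p p k = Qk at *
  generalize qPoch (x * y) p k = w at *
  generalize qPoch y p k = y' at *
  generalize qPoch (-x) p k = x' at *
  generalize (∏ i ∈ Finset.range k, p ^ i) = P at *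
  generalize (p ^ (m + k)) ^ k = R at *
  generalize h ^ ((m + k) ^ 2) = H₁ at *
  generalize h ^ (m ^ 2) = H₂ at *
  trans s * t * (H₁ * P * p ^ k) / R * Y * X * y' * x' / (Qm * Qk * w * W)
  · rcases eq_or_ne W 0 with rfl | hW₀
    · simp
    · field_simp
  · rw [hpow]
    rcases eq_or_ne W 0 with rfl | hW₀
    · simp
    · field_simp

lemma bCoeff_eq {x y p h : ℂ} (hh : h ^ 2 = p) (hp₀ : p ≠ 0)
    (hp : ∀ i : ℕ, 1 - p * p ^ i ≠ 0) (hw : ∀ i : ℕ, 1 - x * y * p ^ i ≠ 0)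
    (hx : ∀ i : ℕ, 1 - -x * p ^ i ≠ 0) (hy : ∀ i : ℕ, 1 - y * p ^ i ≠ 0)
    {n j : ℕ} (hj : j ≤ n + 1) :
    bCoeff x y p h n j =
      psiCoeff x y p h n j * ∑ k ∈ Finset.range (j + 1), innerTerm x y p n j k := by
  rw [bCoeff, Finset.mul_sum]
  refine Finset.sum_congr rfl fun k hk => ?_
  rw [psiCoeff_mul_innerTerm hh hp₀ hp hw hx hy hj (Nat.lt_succ_iff.mp (Finset.mem_range.mp hk))]

/-- The convolution coefficients stop at degree `n`: the next one vanishes. -/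
lemma bCoeff_succ_self {x y p h : ℂ} (hh : h ^ 2 = p) (hp₀ : p ≠ 0)
    (hp : ∀ i : ℕ, 1 - p * p ^ i ≠ 0) (hw : ∀ i : ℕ, 1 - x * y * p ^ i ≠ 0)
    (hx : ∀ i : ℕ, 1 - -x * p ^ i ≠ 0) (hy : ∀ i : ℕ, 1 - y * p ^ i ≠ 0) (n : ℕ) :
    bCoeff x y p h n (n + 1) = 0 := by
  have hn : p ^ n ≠ 0 := pow_ne_zero _ hp₀
  have hc : (p ^ (n + 1))⁻¹ * (x * y * p ^ n) * p = x * y := by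
    rw [pow_succ]; field_simp
  have hterm : ∀ k, innerTerm x y p n (n + 1) k = qPoch (p ^ (n + 1))⁻¹ p k *
      qPoch (x * y * p ^ n) p k /
        (qPoch p p k * qPoch ((p ^ (n + 1))⁻¹ * (x * y * p ^ n) * p) p k) * p ^ k := fun k => by
    have h₁ : x * y * p ^ (2 * n) * p / p ^ (n + 1) = x * y * p ^ n := by field_simp; ring
    have h₂ : y * p ^ n * p / p ^ (n + 1) = y := by rw [pow_succ]; field_simp
    have h₃ : -x * p ^ n * p / p ^ (n + 1) = -x := by rw [pow_succ]; field_simp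
    have hX := qPoch_ne_zero hx k
    have hY := qPoch_ne_zero hy k
    rw [innerTerm, hc, h₁, h₂, h₃, mul_div_mul_right _ _ hX, mul_div_mul_right _ _ hY]
  have hzero : qPoch ((p ^ (n + 1))⁻¹ * p) p (n + 1) = 0 := by
    rw [qPoch_succ, show (p ^ (n + 1))⁻¹ * p * p ^ n = 1 by
      rw [pow_succ]; field_simp]
    simp
  rw [bCoeff_eq hh hp₀ hp hw hx hy le_rfl, Finset.sum_congr rfl fun k _ => hterm k,
    sum_qPoch_telescope hp (by rw [hc]; exact hw), hzero]
  simp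

lemma phiCoeff_zero (x y p h : ℂ) : phiCoeff x y p h 0 = 1 := by
  simp [phiCoeff, qPoch_zero]

lemma bCoeff_zero (x y p h : ℂ) (n : ℕ) : bCoeff x y p h n 0 = 1 := by
  simp [bCoeff, phiCoeff_zero, psiCoeff_zero]

lemma bCoeff_one_rec {x y p : ℂ} (h : ℂ) (hp : ∀ i : ℕ, 1 - p * p ^ i ≠ 0)
    (hw : ∀ i : ℕ, 1 - x * y * p ^ i ≠ 0) (n : ℕ) :
    bCoeff x y p h (n + 1) 1 = bCoeff x y p h n 1 + recA x y p h n := by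
  simp [bCoeff, Finset.sum_range_succ, phiCoeff_zero, psiCoeff_zero, psiCoeff_one_rec h hp hw]
  ring

lemma bCoeff_rec {x y p h : ℂ} (hh : h ^ 2 = p) (hp₀ : p ≠ 0) (hp : ∀ i : ℕ, 1 - p * p ^ i ≠ 0)
    (hw : ∀ i : ℕ, 1 - x * y * p ^ i ≠ 0) {n j : ℕ} (hj : j ≤ n) :
    bCoeff x y p h (n + 2) (j + 2) = bCoeff x y p h (n + 1) (j + 2) +
      recA x y p h (n + 1) * bCoeff x y p h (n + 1) (j + 1) +
      recC x y p n * bCoeff x y p h n j := by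
  have hsplit₂ : ∀ r, bCoeff x y p h r (j + 2) =
      ∑ k ∈ Finset.range (j + 1), phiCoeff x y p h k * psiCoeff x y p h r (j - k + 2) +
        phiCoeff x y p h (j + 1) * psiCoeff x y p h r 1 + phiCoeff x y p h (j + 2) := fun r => by
    rw [bCoeff, Finset.sum_range_succ, Finset.sum_range_succ, Nat.sub_self, psiCoeff_zero,
      show j + 2 - (j + 1) = 1 by omega, mul_one]
    congr 2
    refine Finset.sum_congr rfl fun k hk => ?_
    rw [show j + 2 - k = j - k + 2 by have := Finset.mem_range.mp hk; omega]
  have hsplit₁ : bCoeff x y p h (n + 1) (j + 1) =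
      ∑ k ∈ Finset.range (j + 1), phiCoeff x y p h k * psiCoeff x y p h (n + 1) (j - k + 1) +
        phiCoeff x y p h (j + 1) := by
    rw [bCoeff, Finset.sum_range_succ, Nat.sub_self, psiCoeff_zero, mul_one]
    congr 1
    refine Finset.sum_congr rfl fun k hk => ?_
    rw [show j + 1 - k = j - k + 1 by have := Finset.mem_range.mp hk; omega]
  have hsum : ∑ k ∈ Finset.range (j + 1),
        phiCoeff x y p h k * psiCoeff x y p h (n + 2) (j - k + 2) =
      ∑ k ∈ Finset.range (j + 1), phiCoeff x y p h k * psiCoeff x y p h (n + 1) (j - k + 2) +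
      recA x y p h (n + 1) *
        ∑ k ∈ Finset.range (j + 1), phiCoeff x y p h k * psiCoeff x y p h (n + 1) (j - k + 1) +
      recC x y p n *
        ∑ k ∈ Finset.range (j + 1), phiCoeff x y p h k * psiCoeff x y p h n (j - k) := by
    rw [Finset.mul_sum, Finset.mul_sum, ← Finset.sum_add_distrib, ← Finset.sum_add_distrib]
    refine Finset.sum_congr rfl fun k _ => ?_
    rw [psiCoeff_rec hh hp₀ hp hw (show j - k ≤ n by omega)]
    ring
  rw [hsplit₂, hsplit₂, hsplit₁, hsum, psiCoeff_one_rec h hp hw, bCoeff]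
  ring

/-- The polynomial `∑_j c_{n,j} μ^{n-j}` satisfies the three-term recurrence. -/
lemma sum_bCoeff_rec {x y p h : ℂ} (hh : h ^ 2 = p) (hp₀ : p ≠ 0)
    (hp : ∀ i : ℕ, 1 - p * p ^ i ≠ 0) (hw : ∀ i : ℕ, 1 - x * y * p ^ i ≠ 0)
    (hx : ∀ i : ℕ, 1 - -x * p ^ i ≠ 0) (hy : ∀ i : ℕ, 1 - y * p ^ i ≠ 0) (n : ℕ) (μ : ℂ) :
    ∑ j ∈ Finset.range (n + 3), bCoeff x y p h (n + 2) j * μ ^ (n + 2 - j) =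
      (∑ j ∈ Finset.range (n + 2), bCoeff x y p h (n + 1) j * μ ^ (n + 1 - j)) *
        (μ + recA x y p h (n + 1)) +
      recC x y p n * ∑ j ∈ Finset.range (n + 1), bCoeff x y p h n j * μ ^ (n - j) := by
  have hμ : (∑ j ∈ Finset.range (n + 2), bCoeff x y p h (n + 1) j * μ ^ (n + 1 - j)) * μ =
      ∑ j ∈ Finset.range (n + 3), bCoeff x y p h (n + 1) j * μ ^ (n + 2 - j) := by
    rw [Finset.sum_range_succ _ (n + 2), bCoeff_succ_self hh hp₀ hp hw hx hy, zero_mul, add_zero,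
      Finset.sum_mul]
    refine Finset.sum_congr rfl fun j hj => ?_
    rw [show n + 2 - j = n + 1 - j + 1 by have := Finset.mem_range.mp hj; omega, pow_succ]
    ring
  have hsum : ∑ j ∈ Finset.range (n + 1), bCoeff x y p h (n + 2) (j + 2) * μ ^ (n - j) =
      ∑ j ∈ Finset.range (n + 1), bCoeff x y p h (n + 1) (j + 2) * μ ^ (n - j) +
      recA x y p h (n + 1) *
        ∑ j ∈ Finset.range (n + 1), bCoeff x y p h (n + 1) (j + 1) * μ ^ (n - j) +
      recC x y p n * ∑ j ∈ Finset.range (n + 1), bCoeff x y p h n j * μ ^ (n - j) := by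
    rw [Finset.mul_sum, Finset.mul_sum, ← Finset.sum_add_distrib, ← Finset.sum_add_distrib]
    refine Finset.sum_congr rfl fun j hj => ?_
    rw [bCoeff_rec hh hp₀ hp hw (Nat.lt_succ_iff.mp (Finset.mem_range.mp hj))]
    ring
  rw [mul_add, hμ]
  simp only [Finset.sum_range_succ' _ (n + 2), Finset.sum_range_succ' _ (n + 1),
    Nat.reduceSubDiff, Nat.sub_zero, zero_add, bCoeff_zero, add_assoc,
    Nat.reduceAdd, bCoeff_one_rec h hp hw (n + 1), hsum]
  ring

lemma rpw_add {p : ℝ} (hp : 0 < p) (s t : ℝ) : rpw p (s + t) = rpw p s * rpw p t := by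
  rw [rpw, Real.rpow_add hp, Complex.ofReal_mul, rpw, rpw]

lemma rpw_natCast (p : ℝ) (k : ℕ) : rpw p (k : ℝ) = (p : ℂ) ^ k := by
  rw [rpw, Real.rpow_natCast, Complex.ofReal_pow]

lemma rpw_neg {p : ℝ} (hp : 0 < p) (t : ℝ) : rpw p (-t) = (rpw p t)⁻¹ := by
  rw [rpw, Real.rpow_neg hp.le, Complex.ofReal_inv, rpw]

lemma rpw_ne_zero {p : ℝ} (hp : 0 < p) (t : ℝ) : rpw p t ≠ 0 :=
  Complex.ofReal_ne_zero.mpr (Real.rpow_pos_of_pos hp t).ne'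

lemma one_sub_mul_pow_ne_zero {p c : ℝ} (hp₀ : 0 < p) (hp₁ : p < 1) (hc : c < 1) (i : ℕ) :
    1 - (c : ℂ) * (p : ℂ) ^ i ≠ 0 := by
  have hlt : c * p ^ i < 1 := by
    rcases le_total c 0 with h | h
    · exact (mul_nonpos_of_nonpos_of_nonneg h (pow_pos hp₀ i).le).trans_lt one_pos
    · exact (mul_le_of_le_one_right h (pow_le_one₀ hp₀.le hp₁.le)).trans_lt hc
  exact_mod_cast (sub_pos.mpr hlt).ne'

lemma Aterm_eq_recA {p : ℝ} (hp : 0 < p) (α β : ℝ) (n : ℕ) :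
    Aterm p α β n = recA (rpw p (α + 1)) (rpw p (β + 1)) p (rpw p (1 / 2)) n := by
  have hx := rpw_ne_zero hp (α + 1)
  have hxy : ∀ (t : ℝ) (k : ℕ), t = α + 1 + (β + 1) + k →
      rpw p t = rpw p (α + 1) * rpw p (β + 1) * (p : ℂ) ^ k := by
    rintro t k rfl
    rw [rpw_add hp, rpw_add hp, rpw_natCast]
  rw [Aterm, recA, hxy (α + β + 3 + 2 * n) (2 * n + 1) (by push_cast; ring),
    hxy (α + β + 2 + 2 * n) (2 * n) (by push_cast; ring),
    hxy (α + β + 4 + 2 * n) (2 * n + 2) (by push_cast; ring),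
    show α + 3 / 2 + (n : ℝ) = α + 1 + n + 1 / 2 by ring,
    show β - α = β + 1 + -(α + 1) by ring, rpw_add hp (α + 1 + n), rpw_add hp (α + 1),
    rpw_add hp (β + 1), rpw_neg hp, rpw_natCast]
  field_simp

lemma Cterm_succ_eq_recC {p : ℝ} (hp : 0 < p) (α β : ℝ) (n : ℕ) :
    Cterm p α β (n + 1) = recC (rpw p (α + 1)) (rpw p (β + 1)) p n := by
  have hxy : ∀ (t : ℝ) (k : ℕ), t = α + 1 + (β + 1) + k →
      rpw p t = rpw p (α + 1) * rpw p (β + 1) * (p : ℂ) ^ k := by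
    rintro t k rfl
    rw [rpw_add hp, rpw_add hp, rpw_natCast]
  have hsq : ∀ γ : ℝ, rpw p (2 * γ + 2 + 2 * ((n + 1 : ℕ) : ℝ)) =
      rpw p (γ + 1) ^ 2 * (p : ℂ) ^ (2 * n + 2) := fun γ => by
    rw [show 2 * γ + 2 + 2 * ((n + 1 : ℕ) : ℝ) = (γ + 1) + (γ + 1) + ((2 * n + 2 : ℕ) : ℝ) by
      push_cast; ring, rpw_add hp, rpw_add hp, rpw_natCast, sq]
  rw [Cterm, recC, hsq, hsq,
    hxy (α + β + 2 + 2 * ((n + 1 : ℕ) : ℝ)) (2 * n + 2) (by push_cast; ring),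
    hxy (α + β + 1 + 2 * ((n + 1 : ℕ) : ℝ)) (2 * n + 1) (by push_cast; ring),
    hxy (α + β + 3 + 2 * ((n + 1 : ℕ) : ℝ)) (2 * n + 3) (by push_cast; ring)]

lemma one_sub_rpw_mul_pow_ne_zero {p t : ℝ} (hp₀ : 0 < p) (hp₁ : p < 1) (ht : 0 < t) (i : ℕ) :
    1 - rpw p t * (p : ℂ) ^ i ≠ 0 :=
  one_sub_mul_pow_ne_zero hp₀ hp₁ (Real.rpow_lt_one hp₀.le hp₁ ht) i

lemma one_sub_neg_rpw_mul_pow_ne_zero {p : ℝ} (hp₀ : 0 < p) (hp₁ : p < 1) (t : ℝ) (i : ℕ) :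
    1 - -rpw p t * (p : ℂ) ^ i ≠ 0 := by
  rw [rpw, ← Complex.ofReal_neg]
  exact one_sub_mul_pow_ne_zero hp₀ hp₁ (by linarith [Real.rpow_pos_of_pos hp₀ t]) i

lemma rpw_half_sq {p : ℝ} (hp : 0 < p) : rpw p (1 / 2) ^ 2 = (p : ℂ) := by
  rw [sq, ← rpw_add hp, add_halves, rpw, Real.rpow_one]

lemma bpoly_eq_sum_bCoeff {p α β : ℝ} (hp₀ : 0 < p) (hp₁ : p < 1) (hα : -1 < α) (hβ : -1 < β)
    (n : ℕ) (μ : ℂ) :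
    bpoly p α β n μ = ∑ j ∈ Finset.range (n + 1),
      bCoeff (rpw p (α + 1)) (rpw p (β + 1)) p (rpw p (1 / 2)) n j * μ ^ (n - j) := by
  have hpC : (p : ℂ) ≠ 0 := Complex.ofReal_ne_zero.mpr hp₀.ne'
  have hh := rpw_half_sq hp₀
  have hp := one_sub_mul_pow_ne_zero hp₀ hp₁ hp₁
  have hx := one_sub_neg_rpw_mul_pow_ne_zero hp₀ hp₁ (α + 1)
  have hy := one_sub_rpw_mul_pow_ne_zero hp₀ hp₁ (show 0 < β + 1 by linarith)
  have hw := one_sub_rpw_mul_pow_ne_zero hp₀ hp₁ (show 0 < α + 1 + (β + 1) by linarith)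
  rw [rpw_add hp₀] at hw
  induction n using Nat.twoStepInduction with
  | zero => simp [bpoly, bCoeff_zero]
  | one =>
    have h₀ := bCoeff_succ_self hh hpC hp hw hx hy 0
    rw [zero_add] at h₀
    rw [Finset.sum_range_succ, Finset.sum_range_one, bCoeff_zero,
      bCoeff_one_rec _ hp hw, h₀, bpoly, Aterm_eq_recA hp₀]
    simp
  | more n ih₀ ih₁ =>
    rw [bpoly]
    beta_reduce
    rw [ih₀, ih₁, Aterm_eq_recA hp₀, Cterm_succ_eq_recC hp₀,
      sum_bCoeff_rec hh hpC hp hw hx hy]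

theorem statement3 (q α β : ℝ) (hq0 : 0 < q) (hq1 : q < 1)
    (hα : -1 < α) (hβ : -1 < β)
    (p : ℝ) (hp : p = q ^ ((1 : ℝ)/2)) (n : ℕ) (μ : ℂ) :
    bpoly p α β n μ =
    ∑ j ∈ Finset.range (n + 1),
      (qPoch (rpw p (-β - (n : ℝ) - 1)) (p : ℂ) j *
        qPoch (-(rpw p (-α - (n : ℝ) - 1))) (p : ℂ) j /
        (qPoch (p : ℂ) (p : ℂ) j * qPoch (rpw p (-2*(n : ℝ) - α - β - 2)) (p : ℂ) j)) *
      (-1)^j * rpw p ((j : ℝ)/2) * μ^(n - j) *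
      ∑ k ∈ Finset.range (j + 1),
        (qPoch (rpw p (-(j : ℝ))) (p : ℂ) k *
          qPoch (rpw p (2*(n : ℝ) + α + β + 3 - (j : ℝ))) (p : ℂ) k *
          qPoch (rpw p (β + 1)) (p : ℂ) k * qPoch (-(rpw p (α + 1))) (p : ℂ) k /
          (qPoch (p : ℂ) (p : ℂ) k * qPoch (rpw p (α + β + 2)) (p : ℂ) k *
           qPoch (rpw p ((n : ℝ) + β + 2 - (j : ℝ))) (p : ℂ) k *
           qPoch (-(rpw p (α + (n : ℝ) + 2 - (j : ℝ)))) (p : ℂ) k)) *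
        (p : ℂ)^k := by
  have hp₀ : 0 < p := hp ▸ Real.rpow_pos_of_pos hq0 _
  have hp₁ : p < 1 := hp ▸ Real.rpow_lt_one hq0.le hq1 (by norm_num)
  have hpC : (p : ℂ) ≠ 0 := Complex.ofReal_ne_zero.mpr hp₀.ne'
  have hw := one_sub_rpw_mul_pow_ne_zero hp₀ hp₁ (show 0 < α + 1 + (β + 1) by linarith)
  rw [rpw_add hp₀] at hw
  rw [bpoly_eq_sum_bCoeff hp₀ hp₁ hα hβ]
  refine Finset.sum_congr rfl fun j hj => ?_
  rw [bCoeff_eq (rpw_half_sq hp₀) hpC (one_sub_mul_pow_ne_zero hp₀ hp₁ hp₁) hw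
      (one_sub_neg_rpw_mul_pow_ne_zero hp₀ hp₁ (α + 1))
      (one_sub_rpw_mul_pow_ne_zero hp₀ hp₁ (by linarith)) (Finset.mem_range.mp hj).le,
    ← psiCoeff_eq (rpw_half_sq hp₀) hpC (rpw_ne_zero hp₀ _) (rpw_ne_zero hp₀ _)]
  have hsub : ∀ s t : ℝ, rpw p (s - t) = rpw p s / rpw p t := fun s t => by
    rw [sub_eq_add_neg, rpw_add hp₀, rpw_neg hp₀, div_eq_mul_inv]
  have hone : rpw p 1 = (p : ℂ) := by rw [rpw, Real.rpow_one]
  have hβn : rpw p (-β - n - 1) = (rpw p (β + 1) * (p : ℂ) ^ n)⁻¹ := by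
    rw [show -β - (n : ℝ) - 1 = -(β + 1 + n) by ring, rpw_neg hp₀, rpw_add hp₀, rpw_natCast]
  have hαn : -rpw p (-α - n - 1) = (-rpw p (α + 1) * (p : ℂ) ^ n)⁻¹ := by
    rw [show -α - (n : ℝ) - 1 = -(α + 1 + n) by ring, rpw_neg hp₀, rpw_add hp₀, rpw_natCast,
      neg_mul, inv_neg]
  have h2n : ((2 * n : ℕ) : ℝ) = 2 * n := by push_cast; rfl
  have hαβn : rpw p (-2 * n - α - β - 2) =
      (rpw p (α + 1) * rpw p (β + 1) * (p : ℂ) ^ (2 * n))⁻¹ := by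
    rw [show -2 * (n : ℝ) - α - β - 2 = -(α + 1 + (β + 1) + (2 * n : ℕ)) by rw [h2n]; ring,
      rpw_neg hp₀, rpw_add hp₀, rpw_add hp₀, rpw_natCast]
  have hj₂ : rpw p (j / 2) = rpw p (1 / 2) ^ j := by
    rw [rpw, rpw, ← Complex.ofReal_pow, ← Real.rpow_mul_natCast hp₀.le, one_div_mul_eq_div]
  have hnum : rpw p (2 * n + α + β + 3 - j) =
      rpw p (α + 1) * rpw p (β + 1) * (p : ℂ) ^ (2 * n) * p / (p : ℂ) ^ j := by
    rw [show 2 * (n : ℝ) + α + β + 3 = α + 1 + (β + 1) + (2 * n : ℕ) + 1 by rw [h2n]; ring,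
      hsub, rpw_add hp₀, rpw_add hp₀, rpw_add hp₀, rpw_natCast, rpw_natCast, hone]
  have hβj : rpw p (n + β + 2 - j) = rpw p (β + 1) * (p : ℂ) ^ n * p / (p : ℂ) ^ j := by
    rw [show (n : ℝ) + β + 2 = β + 1 + n + 1 by ring, hsub, rpw_add hp₀, rpw_add hp₀,
      rpw_natCast, rpw_natCast, hone]
  have hαj : -rpw p (α + n + 2 - j) = -rpw p (α + 1) * (p : ℂ) ^ n * p / (p : ℂ) ^ j := by
    rw [show α + (n : ℝ) + 2 = α + 1 + n + 1 by ring, hsub, rpw_add hp₀, rpw_add hp₀,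
      rpw_natCast, rpw_natCast, hone]
    ring
  have hαβ : rpw p (α + β + 2) = rpw p (α + 1) * rpw p (β + 1) := by
    rw [← rpw_add hp₀]
    ring_nf
  rw [hβn, hαn, hαβn, hj₂, hnum, hβj, hαj, hαβ, rpw_neg hp₀, rpw_natCast]
  simp only [innerTerm]
  ring
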